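/- arXiv:1708.06461 — 3 statements merged into one kernel-verified Lean document; each statement's English description precedes it below -/
import Mathlib

section
/- For n ≥ 2, the number of binary partial words of length n that have no abelian borders equals the number of binary total words of length n that have no abelian borders. -/
/-- A partial word over alphabet `α` is a list over `Option α`; `none` is a hole. -/
abbrev PWord (α : Type*) := List (Option α)

/-- `c` is a completion of the partial word `w`: a total word of the same length
agreeing with `w` on every non-hole position. -/
def IsCompletion {α : Type*} (w : PWord α) (c : List α) : Prop :=
  List.Forall₂ (fun o a => ∀ x, o = some x → x = a) w c

/-- Two partial words are abelian compatible if they admit completions that are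
permutations of one another (abelian equivalent). -/
def AbelianCompat {α : Type*} (u v : PWord α) : Prop :=
  ∃ cu cv, IsCompletion u cu ∧ IsCompletion v cv ∧ cu.Perm cv

/-- A partial word `w` has an abelian border of length `k`, `1 ≤ k ≤ |w| - 1`, if
its prefix of length `k` is abelian compatible with its suffix of length `k`. -/
def HasAbelianBorder {α : Type*} (w : PWord α) (k : ℕ) : Prop :=
  1 ≤ k ∧ k ≤ w.length - 1 ∧ AbelianCompat (w.take k) (w.drop (w.length - k))

/-- A total word `w` has an abelian border of length `k`, `1 ≤ k ≤ |w| - 1`, if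
its prefix of length `k` is a permutation of its suffix of length `k`. -/
def HasAbelianBorderT {α : Type*} (w : List α) (k : ℕ) : Prop :=
  1 ≤ k ∧ k ≤ w.length - 1 ∧ (w.take k).Perm (w.drop (w.length - k))

theorem isCompletion_map_some_iff {α : Type*} {l c : List α} :
    IsCompletion (l.map some) c ↔ l = c := by
  simp [IsCompletion, List.forall₂_map_left_iff, List.forall₂_eq_eq_eq]

theorem isCompletion_map_getD {α : Type*} (a : α) (w : PWord α) :
    IsCompletion w (w.map (·.getD a)) := by
  induction w with
  | nil => exact .nil
  | cons o w ih => exact .cons (by rintro x rfl; rfl) ih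

theorem hasAbelianBorder_map_some_iff {α : Type*} (l : List α) (k : ℕ) :
    HasAbelianBorder (l.map some) k ↔ HasAbelianBorderT l k := by
  simp only [HasAbelianBorder, HasAbelianBorderT, AbelianCompat, List.length_map,
    ← List.map_take, ← List.map_drop, isCompletion_map_some_iff]
  simp

/-- Two letters that are not abelian compatible are not holes. -/
theorem exists_eq_some_of_not_abelianCompat_singleton {α : Type*} [Inhabited α] {x y : Option α}
    (h : ¬ AbelianCompat [x] [y]) : ∃ a b, x = some a ∧ y = some b := by
  have key (a : α) (hx : ∀ z, x = some z → z = a) (hy : ∀ z, y = some z → z = a) : False :=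
    h ⟨[a], [a], .cons hx .nil, .cons hy .nil, .refl _⟩
  cases x with
  | none => exact (key (y.getD default) (by simp) (by rintro z rfl; rfl)).elim
  | some a =>
    cases y with
    | none => exact (key a (by simp) (by simp)).elim
    | some b => exact ⟨a, b, rfl, rfl⟩

/-- Filling the hole shared by the two overlapping factors with the outer letters makes them
abelian equivalent. -/
theorem abelianCompat_cons_append_of_none_mem {α : Type*} (a b : α) {m : PWord α}
    (hm : none ∈ m) : AbelianCompat (some a :: m) (m ++ [some b]) := by
  obtain ⟨p, q, rfl⟩ := List.append_of_mem hm
  have hp := isCompletion_map_getD a p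
  have hq := isCompletion_map_getD a q
  have hb : IsCompletion [some b] [b] := .cons (by simp) .nil
  refine ⟨a :: (p.map (·.getD a) ++ b :: q.map (·.getD a)),
    (p.map (·.getD a) ++ a :: q.map (·.getD a)) ++ [b],
    .cons (by simp) (List.rel_append hp (.cons (by simp) hq)),
    List.rel_append (List.rel_append hp (.cons (by simp) hq)) hb, ?_⟩
  classical
  rw [List.perm_iff_count]
  intro z
  simp only [List.count_append, List.count_cons, List.count_nil]
  omega

/-- A partial word of length at least two without abelian borders has no holes. -/
theorem none_notMem_of_forall_not_hasAbelianBorder {α : Type*} [Inhabited α] {w : PWord α}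
    (hw : 2 ≤ w.length) (h : ∀ k, ¬ HasAbelianBorder w k) : none ∉ w := by
  obtain ⟨x, t, rfl⟩ := List.exists_cons_of_length_pos (l := w) (by omega)
  obtain rfl | ⟨m, y, rfl⟩ := List.eq_nil_or_concat' t
  · simp at hw
  have h_first : ¬ AbelianCompat [x] [y] := fun hc ↦ h 1 ⟨le_rfl, by simp, by simpa using hc⟩
  obtain ⟨a, b, rfl, rfl⟩ := exists_eq_some_of_not_abelianCompat_singleton h_first
  intro hmem
  have hm : none ∈ m := by simpa using hmem
  refine h (m.length + 1) ⟨by omega, by simp, ?_⟩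
  simpa using abelianCompat_cons_append_of_none_mem a b hm

theorem List.exists_map_some_eq {α : Type*} {w : List (Option α)} (h : none ∉ w) :
    ∃ l : List α, l.map some = w := by
  have : w ∈ Set.range (List.map (some : α → Option α)) := by
    rw [Set.range_list_map]
    rintro (_ | a) ha
    · exact (h ha).elim
    · exact ⟨a, rfl⟩
  exact this

/-- The number of binary partial words of length `n ≥ 2` with no abelian borders
equals the number of binary total words of length `n` with no abelian borders. -/
theorem stmt_5 (n : ℕ) (hn : 2 ≤ n) :
    Nat.card {w : PWord (Fin 2) // w.length = n ∧ ∀ k, ¬ HasAbelianBorder w k} =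
      Nat.card {w : List (Fin 2) // w.length = n ∧ ∀ k, ¬ HasAbelianBorderT w k} := by
  symm
  refine Nat.card_eq_of_bijective (fun l ↦ ⟨l.1.map some, by simpa using l.2.1, fun k ↦ by
    rw [hasAbelianBorder_map_some_iff]; exact l.2.2 k⟩) ⟨fun l l' h ↦ ?_, fun ⟨w, hw, h⟩ ↦ ?_⟩
  · exact Subtype.ext (List.map_injective_iff.2 (Option.some_injective _) (congrArg Subtype.val h))
  · obtain ⟨l, rfl⟩ := List.exists_map_some_eq
      (none_notMem_of_forall_not_hasAbelianBorder (by omega) h)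
    exact ⟨⟨l, by simpa using hw, fun k hk ↦ h k ((hasAbelianBorder_map_some_iff l k).2 hk)⟩, rfl⟩
end

section
/- Let n ≥ 1 and 0 ≤ m ≤ n−1. The number of binary total words of length n with exactly m distinct abelian borders is: 2^{m/2+1}·(n−m/2−1)! / ((n/2)!·((n−m)/2−1)!) if n and m are both even; 2^{(m−1)/2}·(m+1)·(n−(m+3)/2)! / ((n/2)!·((n−m−1)/2)!) if n is even and m is odd; 2^{m/2+1}·binom(n−m/2−1, (n−1)/2) if n is odd and m is even; and 0 if n and m are both odd. -/
/-- The number of lists of length `n` over `α` satisfying `P`. -/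
noncomputable def listCount {α : Type*} (n : ℕ) (P : List α → Prop) : ℕ :=
  Nat.card {l : List α // l.length = n ∧ P l}

section ListCount

variable {α : Type*}

lemma listCount_congr {n : ℕ} {P Q : List α → Prop}
    (h : ∀ l, l.length = n → (P l ↔ Q l)) : listCount n P = listCount n Q :=
  Nat.card_congr (Equiv.subtypeEquivRight fun l => and_congr_right (h l))

lemma listCount_eq_zero {n : ℕ} {P : List α → Prop}
    (h : ∀ l, l.length = n → ¬ P l) : listCount n P = 0 := by
  have : IsEmpty {l : List α // l.length = n ∧ P l} := ⟨fun l => h l.1 l.2.1 l.2.2⟩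
  exact Nat.card_of_isEmpty

lemma listCount_zero (P : List α → Prop) [Decidable (P [])] :
    listCount 0 P = if P [] then 1 else 0 := by
  split_ifs with h
  · refine Nat.card_eq_one_iff_exists.2 ⟨⟨[], rfl, h⟩, fun l => Subtype.ext ?_⟩
    exact List.length_eq_zero_iff.1 l.2.1
  · refine listCount_eq_zero fun l hl => ?_
    rwa [List.length_eq_zero_iff.1 hl]

lemma listCount_reverse (n : ℕ) (P : List α → Prop) :
    listCount n P = listCount n fun l => P l.reverse :=
  Nat.card_congr (List.reverse_involutive.toPerm.subtypeEquiv fun l => by simp)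

variable [Fintype α]

instance finite_listCount (n : ℕ) (P : List α → Prop) :
    Finite {l : List α // l.length = n ∧ P l} :=
  ((List.finite_length_eq α n).subset fun _ hl => hl.1 : {l : List α | l.length = n ∧ P l}.Finite)

lemma listCount_cons (n : ℕ) (P : List α → Prop) :
    listCount (n + 1) P = ∑ a, listCount n fun l => P (a :: l) := by
  unfold listCount
  rw [← Nat.card_sigma]
  refine Nat.card_congr (Equiv.ofBijective
    (fun x => ⟨x.1 :: x.2.1, by simpa using x.2.2.1, x.2.2.2⟩ :
    (Σ a, {l : List α // l.length = n ∧ P (a :: l)}) → _) ⟨?_, ?_⟩).symm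
  · rintro ⟨a, l, hl⟩ ⟨b, k, hk⟩ h
    simp only [Subtype.mk.injEq, List.cons.injEq] at h
    obtain ⟨rfl, rfl⟩ := h
    rfl
  · rintro ⟨_ | ⟨a, l⟩, hl, hP⟩
    · simp at hl
    · exact ⟨⟨a, l, by simpa using hl, hP⟩, rfl⟩

lemma listCount_concat (n : ℕ) (P : List α → Prop) :
    listCount (n + 1) P = ∑ a, listCount n fun l => P (l ++ [a]) := by
  rw [listCount_reverse, listCount_cons]
  refine Finset.sum_congr rfl fun a _ => ?_
  rw [listCount_reverse]
  simp

lemma listCount_split (n : ℕ) (P Q : List α → Prop) :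
    listCount n P = listCount n (fun l => P l ∧ Q l) + listCount n fun l => P l ∧ ¬ Q l := by
  have hd : Disjoint {l : List α | l.length = n ∧ P l ∧ Q l}
      {l : List α | l.length = n ∧ P l ∧ ¬ Q l} :=
    Set.disjoint_left.2 fun l h h' => h'.2.2 h.2.2
  have h := Set.ncard_union_eq hd (finite_listCount n _) (finite_listCount n _)
  refine Eq.trans ?_ h
  refine congrArg Set.ncard ?_
  refine Set.ext fun l => ?_
  change l.length = n ∧ P l ↔ (l.length = n ∧ P l ∧ Q l) ∨ (l.length = n ∧ P l ∧ ¬ Q l)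
  tauto

end ListCount

/-- The word with the given middle whose `i`-th letters from the left and from the right form the
`i`-th pair of `p`. -/
def wrap {α : Type*} (mid : List α) (p : List (α × α)) : List α :=
  p.foldr (fun s u => s.1 :: (u ++ [s.2])) mid

lemma wrap_cons {α : Type*} (mid : List α) (s : α × α) (p : List (α × α)) :
    wrap mid (s :: p) = s.1 :: (wrap mid p ++ [s.2]) := rfl

lemma length_wrap {α : Type*} (mid : List α) (p : List (α × α)) :
    (wrap mid p).length = mid.length + 2 * p.length := by
  induction p with
  | nil => rfl
  | cons s p ih =>
    simp only [wrap_cons, List.length_cons, List.length_append, List.length_nil, ih]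
    ring

lemma listCount_wrap {α : Type*} [Fintype α] (h : ℕ) (P : List α → Prop) :
    listCount (2 * h) P = listCount h fun p => P (wrap [] p) := by
  classical
  induction h generalizing P with
  | zero =>
    rw [mul_zero, listCount_zero, listCount_zero]
    rfl
  | succ h ih =>
    rw [show 2 * (h + 1) = 2 * h + 1 + 1 by ring, listCount_cons, listCount_cons,
      Fintype.sum_prod_type]
    refine Finset.sum_congr rfl fun a _ => ?_
    rw [listCount_concat]
    exact Finset.sum_congr rfl fun b _ => ih _

lemma listCount_wrap_singleton {α : Type*} [Fintype α] (h : ℕ) (P : List α → Prop) :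
    listCount (2 * h + 1) P = ∑ c, listCount h fun p => P (wrap [c] p) := by
  classical
  induction h generalizing P with
  | zero =>
    rw [mul_zero, listCount_cons]
    refine Finset.sum_congr rfl fun c _ => ?_
    rw [listCount_zero, listCount_zero]
    rfl
  | succ h ih =>
    rw [show 2 * (h + 1) + 1 = 2 * h + 1 + 1 + 1 by ring, listCount_cons]
    simp_rw [listCount_concat (2 * h + 1), ih, listCount_cons h, Fintype.sum_prod_type, wrap_cons]
    rw [Finset.sum_comm]
    conv_rhs => rw [Finset.sum_comm]
    rw [Finset.sum_comm]
    exact Finset.sum_congr rfl fun a _ => Finset.sum_comm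

/-- The excess of ones in the prefix of length `k` over the suffix of length `k`. -/
def imbalance (w : List (Fin 2)) (k : ℕ) : ℤ :=
  (w.take k).count 1 - (w.drop (w.length - k)).count 1

/-- The number of lengths `k` at which the imbalance is `-x`. -/
def borderSum (x : ℤ) (w : List (Fin 2)) : ℕ :=
  ∑ i ∈ Finset.range (w.length - 1), if x + imbalance w (i + 1) = 0 then 1 else 0

lemma perm_iff_count_one {u v : List (Fin 2)} (h : u.length = v.length) :
    u.Perm v ↔ u.count 1 = v.count 1 := by
  have key : ∀ w : List (Fin 2), w.count 0 + w.count 1 = w.length := fun w => by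
    induction w with
    | nil => rfl
    | cons a w ih => fin_cases a <;> simp <;> omega
  refine ⟨fun hp => hp.count_eq 1, fun h1 => List.perm_iff_count.2 fun a => ?_⟩
  have := key u
  have := key v
  fin_cases a <;> simp <;> omega

lemma card_hasAbelianBorderT (w : List (Fin 2)) :
    Nat.card {k // HasAbelianBorderT w k} = borderSum 0 w := by
  rw [borderSum, ← Finset.card_filter]
  have : {k | HasAbelianBorderT w k} =
      (((Finset.range (w.length - 1)).filter fun i => 0 + imbalance w (i + 1) = 0).image
        Nat.succ : Finset ℕ) := by
    ext k
    have hp (hk : k ≤ w.length) : (w.take k).Perm (w.drop (w.length - k)) ↔ imbalance w k = 0 := by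
      rw [perm_iff_count_one (by simp; omega), imbalance]
      omega
    simp only [Set.mem_ofPred_eq, HasAbelianBorderT, Finset.coe_image, Finset.coe_filter,
      Finset.mem_range, zero_add, Set.mem_image, Nat.succ_eq_add_one]
    constructor
    · rintro ⟨h1, h2, h3⟩
      refine ⟨k - 1, ⟨by omega, ?_⟩, by omega⟩
      rw [Nat.sub_add_cancel h1]
      exact (hp (by omega)).1 h3
    · rintro ⟨i, ⟨h1, h2⟩, rfl⟩
      exact ⟨by omega, by omega, (hp (by omega)).2 h2⟩
  change Set.ncard {k | HasAbelianBorderT w k} = _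
  rw [this, Set.ncard_coe_finset, Finset.card_image_of_injective _ Nat.succ_injective]

/-- The increment of the imbalance contributed by a pair of opposite letters. -/
def increment (s : Fin 2 × Fin 2) : ℤ := (s.1.val : ℤ) - s.2.val

lemma count_one_singleton (a : Fin 2) : [a].count 1 = a.val := by
  fin_cases a <;> rfl

lemma imbalance_wrap_one (s : Fin 2 × Fin 2) (u : List (Fin 2)) :
    imbalance (s.1 :: (u ++ [s.2])) 1 = increment s := by
  have h : (s.1 :: (u ++ [s.2])).drop ((s.1 :: (u ++ [s.2])).length - 1) = [s.2] := by
    simp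
  rw [imbalance, h]
  simp [count_one_singleton, increment]

lemma imbalance_wrap_last (s : Fin 2 × Fin 2) (u : List (Fin 2)) :
    imbalance (s.1 :: (u ++ [s.2])) (u.length + 1) = increment s := by
  have h : (s.1 :: (u ++ [s.2])).length - (u.length + 1) = 1 := by
    simp
  rw [imbalance, h]
  have h1 : (List.count 1 (s.1 :: u) : ℤ) = s.1.val + u.count 1 := by
    rw [← List.singleton_append, List.count_append, count_one_singleton]
    push_cast
    rfl
  simp only [List.take_succ_cons, List.take_left, List.drop_succ_cons, List.drop_zero,
    List.count_append, count_one_singleton, h1, increment]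
  push_cast
  ring

lemma imbalance_wrap_succ (s : Fin 2 × Fin 2) (u : List (Fin 2)) {k : ℕ} (hk : k ≤ u.length) :
    imbalance (s.1 :: (u ++ [s.2])) (k + 1) = increment s + imbalance u k := by
  have h : (s.1 :: (u ++ [s.2])).length - (k + 1) = (u.length - k) + 1 := by
    simp; omega
  rw [imbalance, h, List.drop_succ_cons, List.take_succ_cons, ← List.singleton_append,
    List.take_append_of_le_length hk, List.drop_append_of_le_length (by omega),
    List.count_append, List.count_append, count_one_singleton, count_one_singleton, imbalance,
    increment]
  push_cast
  ring

lemma borderSum_wrap (x : ℤ) (s : Fin 2 × Fin 2) {u : List (Fin 2)} (hu : u ≠ []) :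
    borderSum x (s.1 :: (u ++ [s.2])) =
      borderSum (x + increment s) u + 2 * if x + increment s = 0 then 1 else 0 := by
  obtain ⟨n, hn⟩ : ∃ n, u.length = n + 1 :=
    Nat.exists_eq_succ_of_ne_zero (by simpa using hu)
  have hl : (s.1 :: (u ++ [s.2])).length - 1 = n + 1 + 1 := by simp [hn]
  have hlast := imbalance_wrap_last s u
  rw [hn] at hlast
  rw [borderSum, hl, Finset.sum_range_succ, Finset.sum_range_succ', hlast, imbalance_wrap_one,
    borderSum, hn, Nat.add_sub_cancel]
  have : ∀ i ∈ Finset.range n,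
      (if x + imbalance (s.1 :: (u ++ [s.2])) (i + 1 + 1) = 0 then 1 else 0) =
      if x + increment s + imbalance u (i + 1) = 0 then 1 else 0 := fun i hi => by
    rw [imbalance_wrap_succ s u (by have := Finset.mem_range.1 hi; omega), add_assoc]
  rw [Finset.sum_congr rfl this]
  ring

/-- The number of visits to `0`, including at the start, of the walk from `x` with increments given
by `p`. -/
def visits : ℤ → List (Fin 2 × Fin 2) → ℕ
  | x, [] => if x = 0 then 1 else 0
  | x, s :: p => (if x = 0 then 1 else 0) + visits (x + increment s) p

/-- The endpoint of the walk from `x` with increments given by `p`. -/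
def endpoint (x : ℤ) (p : List (Fin 2 × Fin 2)) : ℤ := x + (p.map increment).sum

lemma endpoint_cons (x : ℤ) (s : Fin 2 × Fin 2) (p : List (Fin 2 × Fin 2)) :
    endpoint x (s :: p) = endpoint (x + increment s) p := by
  simp [endpoint, add_assoc]

lemma visits_concat (x : ℤ) (p : List (Fin 2 × Fin 2)) (s : Fin 2 × Fin 2) :
    visits x (p ++ [s]) = visits x p + if endpoint x (p ++ [s]) = 0 then 1 else 0 := by
  induction p generalizing x with
  | nil => simp [visits, endpoint]
  | cons t p ih => simp [visits, ih, endpoint_cons, add_assoc]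

lemma borderSum_wrap_singleton (c : Fin 2) (x : ℤ) (p : List (Fin 2 × Fin 2)) :
    borderSum x (wrap [c] p) + 2 * (if x = 0 then 1 else 0) = 2 * visits x p := by
  induction p generalizing x with
  | nil => simp [wrap, borderSum, visits]
  | cons s p ih =>
    have hne : wrap [c] p ≠ [] := by
      rw [← List.length_pos_iff, length_wrap]; simp
    rw [wrap_cons, borderSum_wrap x s hne, ih, visits]
    ring

lemma borderSum_wrap_nil (x : ℤ) {p : List (Fin 2 × Fin 2)} (hp : p ≠ []) :
    borderSum x (wrap [] p) + 2 * (if x = 0 then 1 else 0) +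
      (if endpoint x p = 0 then 1 else 0) = 2 * visits x p := by
  induction p generalizing x with
  | nil => exact absurd rfl hp
  | cons s p ih =>
    rcases eq_or_ne p [] with rfl | hne
    · have := imbalance_wrap_one s []
      rw [List.nil_append] at this
      have hb : borderSum x [s.1, s.2] = if x + increment s = 0 then 1 else 0 := by
        rw [← this]
        exact Finset.sum_range_one _
      have hw : wrap [] [s] = [s.1, s.2] := rfl
      rw [hw, hb]
      have he : endpoint x [s] = x + increment s := by simp [endpoint]
      rw [he, visits, visits]
      ring
    · have hne' : wrap [] p ≠ [] := by
        rw [← List.length_pos_iff, length_wrap]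
        have := List.length_pos_iff.2 hne
        omega
      have := ih (x + increment s) hne
      rw [wrap_cons, borderSum_wrap x s hne', endpoint_cons, visits]
      linarith

/-- The number of walks of length `h` from `x` to `0` with `r` visits to `0`. -/
noncomputable def bridgeCount (h : ℕ) (x : ℤ) (r : ℕ) : ℕ :=
  listCount h fun p => visits x p = r ∧ endpoint x p = 0

lemma sum_increment {M : Type*} [AddCommMonoid M] (f : ℤ → M) :
    ∑ s, f (increment s) = f 0 + f (-1) + (f 1 + f 0) := by
  simp [Fintype.sum_prod_type, increment]

lemma bridgeCount_zero (x : ℤ) (r : ℕ) :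
    bridgeCount 0 x r = if x = 0 ∧ r = 1 then 1 else 0 := by
  rw [bridgeCount, listCount_zero]
  by_cases hx : x = 0 <;> simp [visits, endpoint, hx, eq_comm]

lemma bridgeCount_succ_of_ne {h : ℕ} {x : ℤ} (hx : x ≠ 0) (r : ℕ) :
    bridgeCount (h + 1) x r =
      bridgeCount h (x - 1) r + 2 * bridgeCount h x r + bridgeCount h (x + 1) r := by
  have := sum_increment fun d => bridgeCount h (x + d) r
  rw [bridgeCount, listCount_cons]
  simp only [visits, endpoint_cons, hx, if_false, zero_add]
  refine this.trans ?_
  rw [add_zero, ← sub_eq_add_neg]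
  ring

lemma bridgeCount_succ_zero (h r : ℕ) :
    bridgeCount (h + 1) 0 (r + 1) =
      bridgeCount h (-1) r + 2 * bridgeCount h 0 r + bridgeCount h 1 r := by
  have := sum_increment fun d => bridgeCount h d r
  rw [bridgeCount, listCount_cons]
  simp only [visits, endpoint_cons, if_true, zero_add, add_comm 1, Nat.add_right_cancel_iff]
  refine this.trans ?_
  ring

lemma visits_pos_of_endpoint {x : ℤ} {p : List (Fin 2 × Fin 2)} (h : endpoint x p = 0) :
    0 < visits x p := by
  induction p generalizing x with
  | nil => simp_all [visits, endpoint]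
  | cons s p ih =>
    have := ih ((endpoint_cons x s p).symm.trans h)
    simp only [visits]
    omega

lemma bridgeCount_zero_right (h : ℕ) (x : ℤ) : bridgeCount h x 0 = 0 :=
  listCount_eq_zero fun _ _ hp => (visits_pos_of_endpoint hp.2).ne' hp.1

lemma bridgeCount_neg (h : ℕ) (x : ℤ) (r : ℕ) : bridgeCount h (-x) r = bridgeCount h x r := by
  induction h generalizing x r with
  | zero => simp [bridgeCount_zero]
  | succ h ih =>
    rcases eq_or_ne x 0 with rfl | hx
    · rw [neg_zero]
    · rw [bridgeCount_succ_of_ne (neg_ne_zero.2 hx), bridgeCount_succ_of_ne hx, ih,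
        show -x - 1 = -(x + 1) by ring, show -x + 1 = -(x - 1) by ring, ih, ih]
      ring

lemma choose_succ_succ_cast (n k : ℕ) :
    ((n + 1).choose (k + 1) : ℚ) = n.choose k + n.choose (k + 1) := by
  exact_mod_cast Nat.choose_succ_succ n k

lemma visits_le (x : ℤ) (p : List (Fin 2 × Fin 2)) : visits x p ≤ p.length + 1 := by
  induction p generalizing x with
  | nil => simp only [visits]; split_ifs <;> simp
  | cons s p ih =>
    have := ih (x + increment s)
    simp only [visits, List.length_cons]
    split_ifs <;> omega

lemma bridgeCount_eq_zero_of_lt {h r : ℕ} (x : ℤ) (hr : h + 1 < r) : bridgeCount h x r = 0 :=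
  listCount_eq_zero fun p hp hv => by
    have := visits_le x p
    omega

lemma bridgeCount_one (x : ℕ) {r : ℕ} (hr : r ≤ 1) :
    (bridgeCount 1 x (r + 1) : ℚ) = 2 ^ r * ((1 - r).choose x - (1 - r).choose (x + 1)) := by
  rcases x with _ | x
  · rw [Nat.cast_zero, bridgeCount_succ_zero]
    interval_cases r <;> simp [bridgeCount_zero]
  · rw [bridgeCount_succ_of_ne (by positivity)]
    have h1 : ((x + 1 : ℕ) : ℤ) ≠ 0 := by positivity
    have h2 : ((x + 1 : ℕ) : ℤ) + 1 ≠ 0 := by positivity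
    have h3 : ((x + 1 : ℕ) : ℤ) - 1 = x := by simp
    simp only [bridgeCount_zero, h1, h2, h3]
    interval_cases r
    · rcases x with _ | x <;> simp [Nat.choose_eq_zero_of_lt]; omega
    · simp

lemma bridgeCount_eq (h x : ℕ) {r : ℕ} (hr : r ≤ h + 1) :
    (bridgeCount (h + 1) x (r + 1) : ℚ) =
      2 ^ r * ((2 * h + 1 - r).choose (h + x) - (2 * h + 1 - r).choose (h + x + 1)) := by
  induction h generalizing x r with
  | zero => simpa using bridgeCount_one x hr
  | succ h ih =>
    rcases x with _ | x
    · rw [Nat.cast_zero, bridgeCount_succ_zero, bridgeCount_neg]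
      rcases r with _ | r
      · have := Nat.choose_symm_half (h + 1)
        simp only [bridgeCount_zero_right]
        simp [this]
      · have h0 := ih 0 (r := r) (by omega)
        have h1 := ih 1 (r := r) (by omega)
        have e : 2 * (h + 1) + 1 - (r + 1) = 2 * h + 1 - r + 1 := by omega
        rw [e, add_zero, choose_succ_succ_cast, choose_succ_succ_cast]
        push_cast at h0 h1 ⊢
        rw [h0, h1]
        simp only [add_zero]
        ring
    · rw [bridgeCount_succ_of_ne (by positivity)]
      rcases hr.lt_or_eq with hr | rfl
      · have h0 := ih x (r := r) (by omega)
        have h1 := ih (x + 1) (r := r) (by omega)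
        have h2 := ih (x + 2) (r := r) (by omega)
        have e : 2 * (h + 1) + 1 - r = 2 * h + 1 - r + 1 + 1 := by omega
        have e1 : ((x + 1 : ℕ) : ℤ) - 1 = x := by simp
        have e2 : ((x + 1 : ℕ) : ℤ) + 1 = (x + 2 : ℕ) := by push_cast; ring
        rw [e, e1, e2, show h + 1 + (x + 1) = h + x + 1 + 1 by ring]
        simp only [choose_succ_succ_cast]
        push_cast at h0 h1 h2 ⊢
        rw [h0, h1, h2]
        simp only [← add_assoc]
        ring
      · rw [Nat.choose_eq_zero_of_lt (show 2 * (h + 1) + 1 - (h + 1 + 1) < h + 1 + (x + 1) by omega),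
          Nat.choose_eq_zero_of_lt
            (show 2 * (h + 1) + 1 - (h + 1 + 1) < h + 1 + (x + 1) + 1 by omega)]
        simp [bridgeCount_eq_zero_of_lt]

/-- The number of walks of length `h` from `0` with `r` returns to `0`. -/
noncomputable def returnCount (h r : ℕ) : ℕ :=
  listCount h fun p => visits 0 p = r + 1

lemma four_mul_returnCount (h r : ℕ) :
    4 * returnCount h r + bridgeCount (h + 1) 0 (r + 1) =
      returnCount (h + 1) r + bridgeCount (h + 1) 0 (r + 2) := by
  have h4 : 4 * returnCount h r = listCount (h + 1) fun p =>
      visits 0 p = r + 1 + if endpoint 0 p = 0 then 1 else 0 := by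
    rw [listCount_concat]
    simp [visits_concat, returnCount]
  rw [h4, returnCount, listCount_split _ _ fun p => endpoint 0 p = 0,
    listCount_split (h + 1) (fun p => visits 0 p = r + 1) fun p => endpoint 0 p = 0]
  have h1 : (listCount (h + 1) fun p => (visits 0 p = r + 1 + if endpoint 0 p = 0 then 1 else 0) ∧
      endpoint 0 p = 0) = bridgeCount (h + 1) 0 (r + 2) :=
    listCount_congr fun p _ => by
      by_cases hp : endpoint 0 p = 0 <;> simp [hp]
  have h2 : (listCount (h + 1) fun p => (visits 0 p = r + 1 + if endpoint 0 p = 0 then 1 else 0) ∧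
      ¬ endpoint 0 p = 0) =
      listCount (h + 1) fun p => visits 0 p = r + 1 ∧ ¬ endpoint 0 p = 0 :=
    listCount_congr fun p _ => by
      by_cases hp : endpoint 0 p = 0 <;> simp [hp]
  rw [h1, h2, ← bridgeCount]
  ring

lemma returnCount_eq_zero_of_lt {h r : ℕ} (hr : h < r) : returnCount h r = 0 :=
  listCount_eq_zero fun p hp hv => by
    have := visits_le 0 p
    omega

lemma returnCount_eq {h r : ℕ} (hr : r ≤ h) :
    (returnCount h r : ℚ) = 2 ^ r * (2 * h - r).choose h := by
  induction h with
  | zero =>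
    obtain rfl : r = 0 := by omega
    simp [returnCount, listCount_zero, visits]
  | succ h ih =>
    have hrec : (4 * returnCount h r + bridgeCount (h + 1) 0 (r + 1) : ℚ) =
      returnCount (h + 1) r + bridgeCount (h + 1) 0 (r + 2) := by
      exact_mod_cast four_mul_returnCount h r
    have hb := bridgeCount_eq h 0 hr
    rw [Nat.cast_zero, add_zero] at hb
    rcases hr.lt_or_eq with hr | rfl
    · have hb' := bridgeCount_eq h 0 (r := r + 1) (by omega)
      have e : 2 * h + 1 - r = 2 * h - r + 1 := by omega
      have e' : 2 * h + 1 - (r + 1) = 2 * h - r := by omega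
      have e'' : 2 * (h + 1) - r = 2 * h - r + 1 + 1 := by omega
      have hc := choose_succ_succ_cast (2 * h - r) h
      have hc' := choose_succ_succ_cast (2 * h - r + 1) h
      rw [e', Nat.cast_zero, add_zero] at hb'
      rw [e] at hb
      rw [hb, hb', ih (by omega)] at hrec
      rw [e'', hc']
      linear_combination -hrec - 2 ^ r * 2 * hc
    · rw [returnCount_eq_zero_of_lt (Nat.lt_succ_self h), hb,
        bridgeCount_eq_zero_of_lt _ (by omega)] at hrec
      rw [show 2 * h + 1 - (h + 1) = h by omega] at hrec
      rw [show 2 * (h + 1) - (h + 1) = h + 1 by omega]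
      simpa using hrec.symm

lemma card_words_eq (n m : ℕ) :
    Nat.card {w : List (Fin 2) // w.length = n ∧ Nat.card {k // HasAbelianBorderT w k} = m} =
      listCount n fun w => borderSum 0 w = m := by
  simp only [card_hasAbelianBorderT, listCount]

lemma listCount_borderSum_odd (h m : ℕ) :
    (listCount (2 * h + 1) fun w => borderSum 0 w = m) =
      2 * listCount h fun p => 2 * visits 0 p = m + 2 := by
  rw [listCount_wrap_singleton, Fin.sum_univ_two, two_mul]
  congr 1 <;>
  · refine listCount_congr fun p _ => ?_
    rw [← borderSum_wrap_singleton, if_pos rfl, mul_one, Nat.add_right_cancel_iff]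

lemma listCount_borderSum_even {h : ℕ} (hh : h ≠ 0) (m : ℕ) :
    (listCount (2 * h) fun w => borderSum 0 w = m) =
      listCount h fun p => 2 * visits 0 p = m + 2 + if endpoint 0 p = 0 then 1 else 0 := by
  rw [listCount_wrap]
  refine listCount_congr fun p hp => ?_
  have hne : p ≠ [] := by rintro rfl; exact hh hp.symm
  rw [← borderSum_wrap_nil 0 hne]
  simp

lemma listCount_borderSum_odd_odd (h r : ℕ) :
    (listCount (2 * h + 1) fun w => borderSum 0 w = 2 * r + 1) = 0 := by
  rw [listCount_borderSum_odd, listCount_eq_zero fun p _ => by omega]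

lemma listCount_borderSum_odd_even (h r : ℕ) :
    (listCount (2 * h + 1) fun w => borderSum 0 w = 2 * r) = 2 * returnCount h r := by
  rw [listCount_borderSum_odd, returnCount]
  congr 1
  exact listCount_congr fun p _ => by omega

lemma listCount_borderSum_even_odd {h : ℕ} (hh : h ≠ 0) (r : ℕ) :
    (listCount (2 * h) fun w => borderSum 0 w = 2 * r + 1) = bridgeCount h 0 (r + 2) := by
  rw [listCount_borderSum_even hh, bridgeCount]
  refine listCount_congr fun p _ => ?_
  split_ifs with hp <;> simp [hp] <;> omega

lemma listCount_borderSum_even_even {h : ℕ} (hh : h ≠ 0) (r : ℕ) :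
    (listCount (2 * h) fun w => borderSum 0 w = 2 * r) + bridgeCount h 0 (r + 1) =
      returnCount h r := by
  rw [listCount_borderSum_even hh, bridgeCount, returnCount,
    listCount_split h (fun p => visits 0 p = r + 1) fun p => endpoint 0 p = 0, add_comm]
  congr 1
  refine listCount_congr fun p _ => ?_
  split_ifs with hp <;> simp [hp] <;> omega

/-- The number of binary total words of length `n` with exactly `m` distinct
abelian borders, by parity of `n` and `m`. -/
theorem stmt_6 (n m : ℕ) (hn : 1 ≤ n) (hm : m ≤ n - 1) :
    (Nat.card {w : List (Fin 2) // w.length = n ∧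
        Nat.card {k // HasAbelianBorderT w k} = m} : ℚ) =
      if Even n ∧ Even m then
        (2 : ℚ) ^ (m / 2 + 1) * ((n - m / 2 - 1).factorial : ℚ) /
          (((n / 2).factorial : ℚ) * (((n - m) / 2 - 1).factorial : ℚ))
      else if Even n ∧ ¬ Even m then
        (2 : ℚ) ^ ((m - 1) / 2) * (m + 1) * ((n - (m + 3) / 2).factorial : ℚ) /
          (((n / 2).factorial : ℚ) * (((n - m - 1) / 2).factorial : ℚ))
      else if ¬ Even n ∧ Even m then
        (2 : ℚ) ^ (m / 2 + 1) * ((n - m / 2 - 1).choose ((n - 1) / 2) : ℚ)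
      else 0 := by
  rw [card_words_eq]
  obtain ⟨h, rfl | rfl⟩ := Nat.even_or_odd' n <;> obtain ⟨r, rfl | rfl⟩ := Nat.even_or_odd' m
  · obtain ⟨t, rfl⟩ : ∃ t, h = r + t + 1 := ⟨h - r - 1, by omega⟩
    rw [if_pos ⟨even_two_mul _, even_two_mul _⟩]
    have hrec : ((listCount (2 * (r + t + 1)) fun w => borderSum 0 w = 2 * r) : ℚ) +
        bridgeCount (r + t + 1) 0 (r + 1) = returnCount (r + t + 1) r := by
      exact_mod_cast listCount_borderSum_even_even (Nat.succ_ne_zero _) r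
    have hb := bridgeCount_eq (r + t) 0 (r := r) (by omega)
    rw [Nat.cast_zero, add_zero] at hb
    have e1 : 2 * (r + t) + 1 - r = r + t + 1 + t := by omega
    have e2 : 2 * (r + t + 1) - r = r + t + 1 + t + 1 := by omega
    rw [hb, returnCount_eq (by omega), e1, e2, choose_succ_succ_cast] at hrec
    have e3 : 2 * r / 2 = r := by omega
    have e4 : 2 * (r + t + 1) - r - 1 = r + t + 1 + t := by omega
    have e5 : 2 * (r + t + 1) / 2 = r + t + 1 := by omega
    have e6 : (2 * (r + t + 1) - 2 * r) / 2 - 1 = t := by omega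
    rw [e3, e4, e5, e6, mul_div_assoc, ← Nat.cast_add_choose]
    linear_combination hrec
  · obtain ⟨t, rfl⟩ : ∃ t, h = r + t + 1 := ⟨h - r - 1, by omega⟩
    rw [if_neg (by simp), if_pos ⟨even_two_mul _, by simp⟩,
      listCount_borderSum_even_odd (Nat.succ_ne_zero _)]
    have hb := bridgeCount_eq (r + t) 0 (r := r + 1) (by omega)
    rw [Nat.cast_zero, add_zero] at hb
    have e1 : 2 * (r + t) + 1 - (r + 1) = r + t + t := by omega
    have e2 : (2 * r + 1 - 1) / 2 = r := by omega
    have e3 : 2 * (r + t + 1) - (2 * r + 1 + 3) / 2 = r + t + t := by omega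
    have e4 : 2 * (r + t + 1) / 2 = r + t + 1 := by omega
    have e5 : (2 * (r + t + 1) - (2 * r + 1) - 1) / 2 = t := by omega
    rw [hb, e1, e2, e3, e4, e5]
    have hs : ((r + t + t).choose (r + t + 1) : ℚ) * (r + t + 1) =
        (r + t + t).choose (r + t) * t := by
      have := Nat.choose_succ_right_eq (r + t + t) (r + t)
      rw [Nat.add_sub_cancel_left] at this
      exact_mod_cast this
    have hf : ((r + t + t).choose (r + t) : ℚ) * (r + t).factorial * t.factorial =
        (r + t + t).factorial := by
      rw [Nat.choose_symm_add]
      exact_mod_cast Nat.add_choose_mul_factorial_mul_factorial (r + t) t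
    rw [eq_div_iff (by positivity), ← hf, Nat.factorial_succ]
    push_cast
    linear_combination -2 ^ (r + 1) * (r + t).factorial * t.factorial * hs
  · rw [if_neg (by simp), if_neg (by simp), if_pos ⟨by simp, even_two_mul _⟩,
      listCount_borderSum_odd_even, Nat.cast_mul, returnCount_eq (by omega)]
    have e1 : 2 * h + 1 - 2 * r / 2 - 1 = 2 * h - r := by omega
    have e2 : (2 * h + 1 - 1) / 2 = h := by omega
    have e3 : 2 * r / 2 = r := by omega
    rw [e1, e2, e3]
    push_cast
    ring
  · rw [if_neg (by simp), if_neg (by simp), if_neg (by simp), listCount_borderSum_odd_odd,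
      Nat.cast_zero]
end

section
/- For every even n ≥ 2, the number of binary partial words of length n with exactly one hole and exactly n−1 distinct abelian borders is 4·(3^{n/2} − 2^{n/2}). -/
/-- The number of ones of a binary partial word. -/
def ones (w : PWord (Fin 2)) : ℕ := w.countP (· == some 1)

/-- The number of holes of a binary partial word. -/
def holes (w : PWord (Fin 2)) : ℕ := w.countP (·.isNone)

theorem ones_cons (o : Option (Fin 2)) (w : PWord (Fin 2)) :
    ones (o :: w) = ones w + ones [o] := by
  simp [ones, List.countP_cons]

theorem holes_cons (o : Option (Fin 2)) (w : PWord (Fin 2)) :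
    holes (o :: w) = holes w + holes [o] := by
  simp [holes, List.countP_cons]

theorem ones_append (u v : PWord (Fin 2)) : ones (u ++ v) = ones u + ones v :=
  List.countP_append

theorem holes_append (u v : PWord (Fin 2)) : holes (u ++ v) = holes u + holes v :=
  List.countP_append

theorem ones_reverse (u : PWord (Fin 2)) : ones u.reverse = ones u :=
  List.countP_reverse

theorem holes_reverse (u : PWord (Fin 2)) : holes u.reverse = holes u :=
  List.countP_reverse

theorem IsCompletion.count_bounds {w : PWord (Fin 2)} {c : List (Fin 2)}
    (h : IsCompletion w c) : ones w ≤ c.count 1 ∧ c.count 1 ≤ ones w + holes w := by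
  induction h with
  | nil => simp [ones]
  | @cons o a w c hoa _ ih =>
    rw [ones_cons, holes_cons, List.count_cons]
    rcases o with _ | x
    · simp only [ones, holes] at *
      fin_cases a <;> simp <;> omega
    · obtain rfl := hoa x rfl
      simp only [ones, holes] at *
      fin_cases x <;> simp <;> omega

theorem exists_isCompletion_count (w : PWord (Fin 2)) (j : ℕ) (h₁ : ones w ≤ j)
    (h₂ : j ≤ ones w + holes w) : ∃ c, IsCompletion w c ∧ c.count 1 = j := by
  induction w generalizing j with
  | nil => exact ⟨[], .nil, by simp_all [ones, holes]⟩
  | cons o w ih =>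
    rw [ones_cons] at h₁ h₂
    rw [holes_cons] at h₂
    rcases o with _ | x
    · simp [ones, holes] at h₁ h₂ ih
      by_cases hj : j ≤ ones w + holes w
      · obtain ⟨c, hc, hcj⟩ := ih j h₁ hj
        exact ⟨0 :: c, .cons (by simp) hc, by simpa using hcj⟩
      · simp only [ones, holes] at hj
        obtain ⟨c, hc, hcj⟩ := ih (j - 1) (by omega) (by omega)
        exact ⟨1 :: c, .cons (by simp) hc, by simp [hcj]; omega⟩
    · fin_cases x
      · simp [ones, holes] at h₁ h₂ ih
        obtain ⟨c, hc, hcj⟩ := ih j h₁ h₂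
        exact ⟨0 :: c, .cons (by simp) hc, by simpa using hcj⟩
      · simp [ones, holes] at h₁ h₂ ih
        obtain ⟨c, hc, hcj⟩ := ih (j - 1) (by omega) (by omega)
        exact ⟨1 :: c, .cons (by simp) hc, by simp [hcj]; omega⟩

theorem count_zero_add_count_one (c : List (Fin 2)) : c.count 0 + c.count 1 = c.length := by
  induction c with
  | nil => rfl
  | cons a c ih => fin_cases a <;> simp <;> omega

theorem abelianCompat_iff {u v : PWord (Fin 2)} (h : u.length = v.length) :
    AbelianCompat u v ↔ ones u ≤ ones v + holes v ∧ ones v ≤ ones u + holes u := by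
  constructor
  · rintro ⟨cu, cv, hu, hv, hp⟩
    have := hu.count_bounds
    have := hv.count_bounds
    have := hp.count_eq 1
    omega
  · rintro ⟨h₁, h₂⟩
    obtain ⟨cu, hu, hcu⟩ :=
      exists_isCompletion_count u (max (ones u) (ones v)) (by omega) (by omega)
    obtain ⟨cv, hv, hcv⟩ :=
      exists_isCompletion_count v (max (ones u) (ones v)) (by omega) (by omega)
    refine ⟨cu, cv, hu, hv, List.perm_iff_count.2 fun a => ?_⟩
    have := count_zero_add_count_one cu
    have := count_zero_add_count_one cv
    have := List.Forall₂.length_eq hu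
    have := List.Forall₂.length_eq hv
    fin_cases a <;> simp <;> omega

/-- A word has all possible abelian borders as soon as it has those of at most half its length. -/
theorem forall_hasAbelianBorder_iff {w : PWord (Fin 2)} {m : ℕ} (hw : w.length = 2 * m) :
    (∀ k, 1 ≤ k → k ≤ w.length - 1 → HasAbelianBorder w k) ↔
      ∀ k ≤ m, ones (w.take k) ≤
          ones (w.drop (w.length - k)) + holes (w.drop (w.length - k)) ∧
        ones (w.drop (w.length - k)) ≤ ones (w.take k) + holes (w.take k) := by
  have key : ∀ k ≤ w.length, (w.take k).length = (w.drop (w.length - k)).length := by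
    intro k hk
    simp
    omega
  constructor
  · intro h k hk
    by_cases hk0 : 1 ≤ k
    · exact (abelianCompat_iff (key k (by omega))).1 (h k hk0 (by omega)).2.2
    · obtain rfl : k = 0 := by omega
      simp [ones]
  · intro h k hk1 hk
    refine ⟨hk1, hk, (abelianCompat_iff (key k (by omega))).2 ?_⟩
    by_cases hkm : k ≤ m
    · exact h k hkm
    · have h' := h (w.length - k) (by omega)
      rw [show w.length - (w.length - k) = k by omega] at h'
      have e₁ : w.take k = w.take (w.length - k) ++ (w.take k).drop (w.length - k) := by
        conv_lhs => rw [← List.take_append_drop (w.length - k) (w.take k)]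
        rw [List.take_take, min_eq_left (by omega)]
      have e₂ : w.drop (w.length - k) = (w.take k).drop (w.length - k) ++ w.drop k := by
        conv_lhs => rw [← List.take_append_drop k w]
        rw [List.drop_append_of_le_length (by simp; omega)]
        simp
      rw [e₁, e₂]
      simp only [ones_append, holes_append]
      omega

theorem card_hasAbelianBorder_iff {α : Type*} (w : PWord α) :
    Nat.card {k // HasAbelianBorder w k} = w.length - 1 ↔
      ∀ k, 1 ≤ k → k ≤ w.length - 1 → HasAbelianBorder w k := by
  have hsub : {k | HasAbelianBorder w k} ⊆ (Finset.Icc 1 (w.length - 1) : Finset ℕ) :=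
    fun k hk => by simpa using ⟨hk.1, hk.2.1⟩
  constructor
  · intro h k hk1 hk
    have heq := Set.eq_of_subset_of_ncard_le hsub
      (by rw [Set.ncard_coe_finset, Nat.card_Icc, ← Nat.card_coe_set_eq]; exact h.ge)
      (Finset.finite_toSet _)
    have : k ∈ {k | HasAbelianBorder w k} := by rw [heq]; simp [hk1, hk]
    exact this
  · intro h
    have heq : {k | HasAbelianBorder w k} = (Finset.Icc 1 (w.length - 1) : Finset ℕ) :=
      hsub.antisymm fun k hk => by
        simp only [Finset.coe_Icc, Set.mem_Icc] at hk
        exact h k hk.1 hk.2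
    change Nat.card {k | HasAbelianBorder w k} = _
    rw [heq, Nat.card_coe_set_eq, Set.ncard_coe_finset, Nat.card_Icc, Nat.add_sub_cancel]

/-- A word of even length folded in the middle: the list of pairs of letters at
symmetric positions, from the outside in. -/
abbrev FoldedWord := List (Option (Fin 2) × Option (Fin 2))

/-- The partial word obtained by unfolding a list of pairs. -/
def FoldedWord.unfold (l : FoldedWord) : PWord (Fin 2) :=
  l.map Prod.fst ++ (l.map Prod.snd).reverse

theorem FoldedWord.unfold_injective : Function.Injective FoldedWord.unfold := by
  intro l l' h
  have hlen : l.length = l'.length := by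
    have := congrArg List.length h
    simp [unfold] at this
    omega
  obtain ⟨h₁, h₂⟩ := List.append_inj h (by simpa using hlen)
  rw [List.reverse_inj] at h₂
  rw [← List.zip_unzip l, ← List.zip_unzip l']
  simp only [List.unzip_eq_map, h₁, h₂]

theorem FoldedWord.exists_unfold {w : PWord (Fin 2)} {m : ℕ} (hw : w.length = 2 * m) :
    ∃ l : FoldedWord, l.unfold = w := by
  refine ⟨(w.take m).zip (w.drop m).reverse, ?_⟩
  rw [unfold, List.map_fst_zip (by simp; omega), List.map_snd_zip (by simp; omega)]
  simp

/-- The folded word `l` has one hole, counting `h` initial ones, and all its prefixes are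
compatible on both sides, counting initial slacks `a` and `b`. -/
def Admissible (h : ℕ) (a b : ℤ) (l : FoldedWord) : Prop :=
  h + holes (l.map Prod.fst) + holes (l.map Prod.snd) = 1 ∧
    ∀ k, 0 ≤ a + ones ((l.take k).map Prod.snd) + holes ((l.take k).map Prod.snd)
        - ones ((l.take k).map Prod.fst) ∧
      0 ≤ b + ones ((l.take k).map Prod.fst) + holes ((l.take k).map Prod.fst)
        - ones ((l.take k).map Prod.snd)

theorem admissible_nil {h : ℕ} {a b : ℤ} :
    Admissible h a b [] ↔ h = 1 ∧ 0 ≤ a ∧ 0 ≤ b := by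
  simp [Admissible, ones, holes]

theorem Admissible.nonneg {h : ℕ} {a b : ℤ} {l : FoldedWord} (hl : Admissible h a b l) :
    0 ≤ a ∧ 0 ≤ b := by
  simpa [ones, holes] using hl.2 0

theorem admissible_cons {h : ℕ} {a b : ℤ} (ha : 0 ≤ a) (hb : 0 ≤ b)
    (p : Option (Fin 2) × Option (Fin 2)) (l : FoldedWord) :
    Admissible h a b (p :: l) ↔ Admissible (h + holes [p.1] + holes [p.2])
      (a + ones [p.2] + holes [p.2] - ones [p.1])
      (b + ones [p.1] + holes [p.1] - ones [p.2]) l := by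
  refine and_congr ?_ ⟨fun hl k => ?_, fun hl k => ?_⟩
  · simp only [List.map_cons]
    rw [holes_cons p.1, holes_cons p.2]
    omega
  · have := hl (k + 1)
    simp only [List.take_succ_cons, List.map_cons] at this
    rw [ones_cons p.1, holes_cons p.1, ones_cons p.2, holes_cons p.2] at this
    push_cast at this
    omega
  · rcases k with _ | k
    · simpa [ones, holes] using ⟨ha, hb⟩
    · have := hl k
      simp only [List.take_succ_cons, List.map_cons]
      rw [ones_cons p.1, holes_cons p.1, ones_cons p.2, holes_cons p.2]
      push_cast
      omega

theorem admissible_unfold_iff {l : FoldedWord} {m : ℕ} (hl : l.length = m) :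
    Admissible 0 0 0 l ↔ holes l.unfold = 1 ∧
      ∀ k ≤ m, ones (l.unfold.take k) ≤
          ones (l.unfold.drop (l.unfold.length - k)) +
            holes (l.unfold.drop (l.unfold.length - k)) ∧
        ones (l.unfold.drop (l.unfold.length - k)) ≤
          ones (l.unfold.take k) + holes (l.unfold.take k) := by
  have htake : ∀ k ≤ m, l.unfold.take k = (l.take k).map Prod.fst := by
    intro k hk
    rw [FoldedWord.unfold, List.take_append_of_le_length (by simp; omega), List.map_take]
  have hdrop : ∀ k ≤ m,
      l.unfold.drop (l.unfold.length - k) = ((l.take k).map Prod.snd).reverse := by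
    intro k hk
    rw [← List.reverse_inj, List.reverse_reverse, ← List.take_reverse, FoldedWord.unfold,
      List.reverse_append, List.reverse_reverse,
      List.take_append_of_le_length (by simp; omega), List.map_take]
  refine and_congr ?_ ⟨fun h k hk => ?_, fun h k => ?_⟩
  · rw [FoldedWord.unfold, holes_append, holes_reverse]
    omega
  · rw [htake k hk, hdrop k hk, ones_reverse, holes_reverse]
    have := h k
    omega
  · have hmin : l.take k = l.take (min k m) := by
      rcases le_total k m with hk | hk
      · rw [min_eq_left hk]
      · rw [min_eq_right hk, List.take_of_length_le (by omega),
          List.take_of_length_le (by omega)]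
    have := h (min k m) (min_le_right _ _)
    rw [htake _ (min_le_right _ _), hdrop _ (min_le_right _ _), ones_reverse,
      holes_reverse, ← hmin] at this
    omega

theorem natCard_list_succ {α : Type*} [Fintype α] (P : List α → Prop) (m : ℕ) :
    Nat.card {l : List α // l.length = m + 1 ∧ P l} =
      ∑ x, Nat.card {l : List α // l.length = m ∧ P (x :: l)} := by
  have hfin : ∀ x, Finite {l : List α // l.length = m ∧ P (x :: l)} := fun x =>
    ((List.finite_length_eq α m).subset fun l hl => hl.1 :
      {l : List α | l.length = m ∧ P (x :: l)}.Finite).to_subtype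
  rw [← Nat.card_sigma]
  refine (Nat.card_congr (Equiv.ofBijective
    (fun s : Σ x, {l : List α // l.length = m ∧ P (x :: l)} =>
      (⟨s.1 :: s.2.1, by simpa using s.2.2⟩ :
        {l : List α // l.length = m + 1 ∧ P l})) ⟨?_, ?_⟩)).symm
  · rintro ⟨x, l, hl⟩ ⟨y, l', hl'⟩ h
    simp only [Subtype.mk.injEq, List.cons.injEq] at h
    obtain ⟨rfl, rfl⟩ := h
    rfl
  · rintro ⟨_ | ⟨x, l⟩, hl⟩
    · simp at hl
    · exact ⟨⟨x, l, by simpa using hl⟩, rfl⟩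

/-- The number of admissible folded words of a given length. -/
noncomputable def admissibleCount (m h : ℕ) (a b : ℤ) : ℕ :=
  Nat.card {l : FoldedWord // l.length = m ∧ Admissible h a b l}

theorem admissibleCount_eq_zero {m h : ℕ} {a b : ℤ} (hab : a < 0 ∨ b < 0 ∨ 2 ≤ h) :
    admissibleCount m h a b = 0 := by
  have : IsEmpty {l : FoldedWord // l.length = m ∧ Admissible h a b l} := by
    refine ⟨fun ⟨l, _, hl⟩ => ?_⟩
    have := hl.nonneg
    have := hl.1
    omega
  exact Nat.card_of_isEmpty

theorem admissibleCount_zero (h : ℕ) {a b : ℤ} (ha : 0 ≤ a) (hb : 0 ≤ b) :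
    admissibleCount 0 h a b = if h = 1 then 1 else 0 := by
  have : ∀ l : FoldedWord, l.length = 0 ∧ Admissible h a b l ↔ l = [] ∧ h = 1 := by
    intro l
    rw [List.length_eq_zero_iff]
    refine and_congr_right fun hl => ?_
    rw [hl, admissible_nil]
    tauto
  simp only [admissibleCount, this]
  split_ifs with h1 <;> simp [h1]

theorem admissibleCount_succ (m h : ℕ) {a b : ℤ} (ha : 0 ≤ a) (hb : 0 ≤ b) :
    admissibleCount (m + 1) h a b = ∑ p : Option (Fin 2) × Option (Fin 2),
      admissibleCount m (h + holes [p.1] + holes [p.2])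
        (a + ones [p.2] + holes [p.2] - ones [p.1])
        (b + ones [p.1] + holes [p.1] - ones [p.2]) := by
  simp only [admissibleCount, natCard_list_succ, admissible_cons ha hb]

theorem admissibleCount_one (m : ℕ) :
    admissibleCount m 1 1 0 = 3 ^ m ∧ admissibleCount m 1 0 1 = 3 ^ m := by
  induction m with
  | zero => simp [admissibleCount_zero]
  | succ m ih =>
    obtain ⟨h₁, h₂⟩ := ih
    constructor <;> rw [admissibleCount_succ _ _ (by norm_num) (by norm_num)] <;>
      simp [Fintype.sum_prod_type, Fintype.sum_option, Fin.sum_univ_two, ones, holes,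
        admissibleCount_eq_zero, h₁, h₂] <;> ring

theorem admissibleCount_main (m : ℕ) :
    admissibleCount m 0 0 0 + 4 * 2 ^ m = 4 * 3 ^ m := by
  induction m with
  | zero => simp [admissibleCount_zero]
  | succ m ih =>
    obtain ⟨h₁, h₂⟩ := admissibleCount_one m
    rw [admissibleCount_succ _ _ le_rfl le_rfl]
    simp [Fintype.sum_prod_type, Fintype.sum_option, Fin.sum_univ_two, ones, holes,
      admissibleCount_eq_zero, h₁, h₂]
    rw [pow_succ, pow_succ]
    omega

/-- For even `n ≥ 2`, the number of binary partial words of length `n` with exactly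
one hole and exactly `n - 1` distinct abelian borders is `4 * (3^(n/2) - 2^(n/2))`. -/
theorem stmt_10 (n : ℕ) (hn : 2 ≤ n) (he : Even n) :
    Nat.card {w : PWord (Fin 2) // w.length = n ∧ w.countP (·.isNone) = 1 ∧
        Nat.card {k // HasAbelianBorder w k} = n - 1} =
      4 * (3 ^ (n / 2) - 2 ^ (n / 2)) := by
  obtain ⟨m, rfl⟩ : ∃ m, n = 2 * m := he.exists_two_nsmul.imp fun m hm => by simpa using hm
  rw [Nat.mul_div_cancel_left m two_pos]
  have hset : {w : PWord (Fin 2) | w.length = 2 * m ∧ w.countP (·.isNone) = 1 ∧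
      Nat.card {k // HasAbelianBorder w k} = 2 * m - 1} =
      FoldedWord.unfold '' {l | l.length = m ∧ Admissible 0 0 0 l} := by
    have hlen : ∀ l : FoldedWord, l.unfold.length = 2 * l.length := fun l => by
      simp [FoldedWord.unfold, two_mul]
    have hiff : ∀ w : PWord (Fin 2), w.length = 2 * m →
        (Nat.card {k // HasAbelianBorder w k} = 2 * m - 1 ↔ _) := fun w hw =>
      (iff_of_eq (congrArg (fun n => _ = n - 1) hw.symm)).trans <|
        (card_hasAbelianBorder_iff w).trans (forall_hasAbelianBorder_iff hw)
    ext w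
    constructor
    · rintro ⟨hw, h₁, h₂⟩
      obtain ⟨l, rfl⟩ := FoldedWord.exists_unfold hw
      have hl : l.length = m := by
        have := hlen l
        omega
      exact ⟨l, ⟨hl, (admissible_unfold_iff hl).2 ⟨h₁, (hiff _ hw).1 h₂⟩⟩, rfl⟩
    · rintro ⟨l, ⟨hl, hadm⟩, rfl⟩
      have hw : l.unfold.length = 2 * m := by rw [hlen, hl]
      obtain ⟨h₁, h₂⟩ := (admissible_unfold_iff hl).1 hadm
      exact ⟨hw, h₁, (hiff _ hw).2 h₂⟩
  have hcard : Nat.card {w : PWord (Fin 2) // w.length = 2 * m ∧ w.countP (·.isNone) = 1 ∧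
      Nat.card {k // HasAbelianBorder w k} = 2 * m - 1} = admissibleCount m 0 0 0 := by
    change Nat.card {w : PWord (Fin 2) | _} = _
    rw [hset, Nat.card_image_of_injective FoldedWord.unfold_injective]
    rfl
  rw [hcard, Nat.mul_sub]
  exact Nat.eq_sub_of_add_eq (admissibleCount_main m)
end
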